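/- For any K ≥ 2 and any horizon T ≥ (8/(3·√(3·(e−2)³)))·K·ln K (numerically T ≥ 2.577·K·ln K), if POLA is run with learning rate η = √( ln K / ( (e−2)·K·( (3/4)·((T+1)⁴/(K·ln K))^{1/3} + (K·ln K)/4 ) ) ), then for any assignment of rewards x_t(j) ∈ [0,1] the expected regret satisfies G_max − E[G_POLA] ≤ (√(3·(e−2)) + 3/2)·(T²·K·ln K)^{1/3}, where G_max = max_j ∑_{t=1}^T x_t(j) and G_POLA is the total reward collected by POLA. -/

import Mathlib

/-!
Model of the POLA algorithm.  There are `K` channels and `T` time slots with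
rewards `x t j ∈ [0,1]` (round `t+1` of the paper is indexed by
`t ∈ {0,…,T-1}`).  The randomness that influences the evolution of the
weights is, per round, whether the round is an observation round and, in that
case, which channel was observed.  We encode this by a history
`c : Fin T → Option (Fin K)`, where `c t = some j` means round `t` was an
observation round with observed channel `j`, and `c t = none` means round `t`
was an attack round (the attacked channel does not affect the weights).
-/

/-- The POLA observation probability `δ_t = min{1, (K·ln K/t)^{1/3}}` of
round `t+1` (0-based index `t`). -/
noncomputable def polaDelta (K t : ℕ) : ℝ :=
  min 1 (((K : ℝ) * Real.log K / ((t : ℝ) + 1)) ^ ((1 : ℝ) / 3))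

/-- Weights of POLA along a history `c`: `w 0 i = 1`; on an observation round
with observed channel `j'`, `w (t+1) j = w t j · exp(η·x̂ t j)` with
`x̂ t j = x t j · K/δ_t` if `j = j'` and `0` otherwise; on an attack round the
weights are unchanged. -/
noncomputable def polaWeight (K T : ℕ) (x : ℕ → Fin K → ℝ) (η : ℝ)
    (c : Fin T → Option (Fin K)) : ℕ → Fin K → ℝ
  | 0 => fun _ => 1
  | t + 1 => fun j =>
      polaWeight K T x η c t j *
        Real.exp (η *
          (if h : t < T then
            (match c ⟨t, h⟩ with
             | some j' => if j' = j then x t j * (K : ℝ) / polaDelta K t else 0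
             | none => 0)
          else 0))

/-- POLA attack distribution `p t i = w t i / ∑ j, w t j`. -/
noncomputable def polaP (K T : ℕ) (x : ℕ → Fin K → ℝ) (η : ℝ)
    (c : Fin T → Option (Fin K)) (t : ℕ) (i : Fin K) : ℝ :=
  polaWeight K T x η c t i / ∑ j, polaWeight K T x η c t j

/-- Probability of the history `c`: with probability `δ_t` the round is an
observation round and the observed channel is uniform among the `K` channels
(probability `δ_t·(1/K)` for each), and with probability `1 − δ_t` it is an
attack round. -/
noncomputable def polaHistProb (K T : ℕ) (c : Fin T → Option (Fin K)) : ℝ :=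
  ∏ t : Fin T,
    (match c t with
     | some _ => polaDelta K (t : ℕ) * (1 / (K : ℝ))
     | none => 1 - polaDelta K (t : ℕ))

/-- Expected total reward `E[G_POLA] = E[∑_t R_t]`, where `R_t = x t (I_t)`
with `I_t ∼ p_t` on attack rounds and `R_t = 0` on observation rounds: given
a history, the conditional expectation of the reward of an attack round `t`
is `∑ i, p t i · x t i`. -/
noncomputable def polaGain (K T : ℕ) (x : ℕ → Fin K → ℝ) (η : ℝ) : ℝ :=
  ∑ c : Fin T → Option (Fin K), polaHistProb K T c *
      ∑ t : Fin T,
        (match c t with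
         | none => ∑ i, polaP K T x η c (t : ℕ) i * x (t : ℕ) i
         | some _ => 0)

theorem exp_le_one_add_add_sq {y : ℝ} (h0 : 0 ≤ y) (h1 : y ≤ 1) :
    Real.exp y ≤ 1 + y + (Real.exp 1 - 2) * y ^ 2 := by
  have hs (z : ℝ) : HasSum (fun n : ℕ => z ^ (n + 2) / ((n + 2).factorial : ℝ))
      (Real.exp z - (1 + z)) := by
    have := (hasSum_nat_add_iff' 2).2 (Real.exp_eq_exp_ℝ ▸ NormedSpace.expSeries_div_hasSum_exp z)
    simpa [Finset.sum_range_succ] using this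
  have h := hasSum_le (fun n : ℕ => ?_) (hs y) ((hs 1).mul_left (y ^ 2))
  · linarith
  · rw [one_pow, mul_one_div, pow_add]
    gcongr
    exact mul_le_of_le_one_left (sq_nonneg y) (pow_le_one₀ h0 h1)

theorem rescaled_tuning_bound {q r h y : ℝ} (hq : 1.36 ≤ q) (hr : 0 < r) (h0 : 0 ≤ h)
    (h1 : h ≤ 0.7214) (hrq : r ^ 3 = q ^ 3 + h) (hy : 0 < y)
    (hyr : y ^ 2 = 3 / 4 * r ^ 4 + 1 / 4) :
    2 * y - h / y ≤ Real.sqrt 3 * q ^ 2 + 0.589 := by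
  have hq0 : 0 < q := by linarith
  have hqr : q ≤ r := le_of_pow_le_pow_left₀ three_ne_zero hr.le (by linarith)
  have hs : Real.sqrt 3 ^ 2 = 3 := Real.sq_sqrt (by norm_num)
  have hs0 : 0 ≤ Real.sqrt 3 := Real.sqrt_nonneg 3
  have hs1 : Real.sqrt 3 ≤ 1.7321 := by
    rw [Real.sqrt_le_left (by norm_num)]; norm_num
  have hy2 : 2 * y ≤ Real.sqrt 3 * (r ^ 2 + 1 / (6 * r ^ 2)) := by
    refine le_of_sq_le_sq ?_ (by positivity)
    have : (Real.sqrt 3 * (r ^ 2 + 1 / (6 * r ^ 2))) ^ 2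
        = 3 * r ^ 4 + 1 + 1 / (12 * r ^ 4) := by
      rw [mul_pow, hs]; field_simp; ring
    rw [this, mul_pow, hyr]
    have : 0 ≤ 1 / (12 * r ^ 4) := by positivity
    linarith
  have hd : r ^ 2 ≤ q ^ 2 + 2 * h / (3 * q) := by
    rw [← sub_le_iff_le_add', le_div_iff₀ (by positivity)]
    have : h = r ^ 3 - q ^ 3 := by linarith
    rw [this]
    nlinarith [mul_nonneg (sq_nonneg (r - q)) (by linarith : 0 ≤ 2 * r + q)]
  have hi : 1 / (6 * r ^ 2) ≤ 1 / (6 * q ^ 2) := by gcongr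
  have hmain : 2 * y - Real.sqrt 3 * q ^ 2 ≤ 1.7321 * (2 * h / (3 * q) + 1 / (6 * q ^ 2)) := by
    have : 0 ≤ 2 * h / (3 * q) + 1 / (6 * q ^ 2) := by positivity
    have h2 := mul_le_mul_of_nonneg_right hs1 this
    have h3 := mul_le_mul_of_nonneg_left (add_le_add hd hi) hs0
    linarith
  rcases le_total q 1.75 with hc | hc
  · have hr3 : r ^ 3 ≤ 1.826 ^ 3 := by
      have : q ^ 3 ≤ 1.75 ^ 3 := by gcongr
      rw [hrq]; norm_num at this ⊢; linarith
    have hr1 : r ≤ 1.826 := le_of_pow_le_pow_left₀ three_ne_zero (by norm_num) hr3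
    have hy1 : y ≤ 2.94 := by
      have : r ^ 4 ≤ 1.826 ^ 4 := by gcongr
      refine le_of_sq_le_sq ?_ (by norm_num)
      rw [hyr]; norm_num at this ⊢; linarith
    have e1 : h / 2.94 ≤ h / y := by gcongr
    have e2 : 2 * h / (3 * q) ≤ 2 * h / (3 * 1.36) := by gcongr
    have e3 : 1 / (6 * q ^ 2) ≤ 1 / (6 * 1.36 ^ 2) := by gcongr
    norm_num at *
    linarith
  · have e1 : 0 ≤ h / y := by positivity
    have e2 : 2 * h / (3 * q) ≤ 2 * 0.7214 / (3 * 1.75) := by gcongr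
    have e3 : 1 / (6 * q ^ 2) ≤ 1 / (6 * 1.75 ^ 2) := by gcongr
    norm_num at *
    linarith

theorem exists_cube_root {z : ℝ} (hz : 0 ≤ z) :
    ∃ v : ℝ, 0 ≤ v ∧ v ^ 3 = z ∧ z ^ ((1 : ℝ) / 3) = v := by
  refine ⟨z ^ ((1 : ℝ) / 3), Real.rpow_nonneg hz _, ?_, rfl⟩
  rw [← Real.rpow_natCast, ← Real.rpow_mul hz]
  norm_num

theorem rpow_one_third_eq {z v : ℝ} (hv : 0 ≤ v) (h : v ^ 3 = z) : z ^ ((1 : ℝ) / 3) = v := by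
  rw [← h, ← Real.rpow_natCast, ← Real.rpow_mul hv]
  norm_num

theorem polaDelta_eq {K t : ℕ} {a v : ℝ} (ha : 0 < a) (haK : a ^ 3 = K * Real.log K)
    (hv : 0 < v) (hvt : v ^ 3 = (t : ℝ) + 1) : polaDelta K t = min 1 (a / v) := by
  rw [polaDelta, rpow_one_third_eq (div_pos ha hv).le]
  rw [div_pow, haK, hvt]

theorem polaDelta_le_one (K t : ℕ) : polaDelta K t ≤ 1 := min_le_left _ _

theorem pos_of_cube_eq_succ {v : ℝ} {n : ℕ} (hv : 0 ≤ v) (h : v ^ 3 = (n : ℝ) + 1) : 0 < v := by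
  rcases hv.eq_or_lt with rfl | hv
  · have : (0 : ℝ) ≤ n := n.cast_nonneg
    norm_num at h
    linarith
  · exact hv

theorem sum_polaDelta_le {K : ℕ} {a : ℝ} (ha : 0 < a) (haK : a ^ 3 = K * Real.log K) (n : ℕ) :
    ∀ v : ℝ, v ^ 3 = n → a ≤ v →
      ∑ t ∈ Finset.range n, polaDelta K t ≤ 3 / 2 * v ^ 2 * a - a ^ 3 / 2 := by
  induction n with
  | zero =>
    intro v hv hav
    have : 0 < v ^ 3 := by have := ha.trans_le hav; positivity
    simp [hv] at this
  | succ n ih =>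
    intro w hw haw
    have hw0 := ha.trans_le haw
    push_cast at hw
    obtain ⟨v, hv0, hv, -⟩ := exists_cube_root n.cast_nonneg
    have hδ : polaDelta K n ≤ a / w := by
      rw [polaDelta_eq ha haK hw0 hw]; exact min_le_right _ _
    rw [Finset.sum_range_succ]
    rcases le_total a v with hav | hva
    · have h := ih v hv hav
      have : a / w ≤ 3 / 2 * a * (w ^ 2 - v ^ 2) := by
        rw [div_le_iff₀ hw0]
        have h1 : w ^ 3 - v ^ 3 = 1 := by linarith
        have h2 : 0 ≤ (w - v) ^ 2 * (w + 2 * v) := by positivity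
        have h3 : 2 * (w ^ 3 - v ^ 3) ≤ 3 * w * (w ^ 2 - v ^ 2) := by nlinarith
        rw [h1] at h3
        nlinarith
      linarith
    · have h : ∑ t ∈ Finset.range n, polaDelta K t ≤ w ^ 3 - 1 := by
        refine (Finset.sum_le_card_nsmul _ _ 1 fun t _ => polaDelta_le_one K t).trans ?_
        simp [hw]
      have h1 : w ^ 3 - a ^ 3 ≤ 1 := by
        have : v ^ 3 ≤ a ^ 3 := by gcongr
        linarith
      have h2 : w ^ 3 - 1 + a / w ≤ 3 / 2 * w ^ 2 * a - a ^ 3 / 2 := by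
        have h3 : 1 - a / w = (w - a) / w := by field_simp
        have h4 : (w - a) * (2 * w + a) * w ≤ 2 := by
          nlinarith [mul_nonneg (sub_nonneg.2 haw) (by positivity : 0 ≤ a * w + 2 * a ^ 2)]
        have h5 : (w - a) ^ 2 * (2 * w + a) ≤ 2 * ((w - a) / w) := by
          rw [← mul_div_assoc, le_div_iff₀ hw0]
          nlinarith [mul_le_mul_of_nonneg_left h4 (sub_nonneg.2 haw)]
        nlinarith
      linarith

theorem sum_inv_polaDelta_le {K : ℕ} {a : ℝ} (ha : 0 < a) (haK : a ^ 3 = K * Real.log K)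
    (n : ℕ) : ∀ w : ℝ, 0 < w → w ^ 3 = (n : ℝ) + 1 →
      ∑ t ∈ Finset.range n, 1 / polaDelta K t ≤ 3 / 4 * w ^ 4 / a + a ^ 3 / 4 - 1 := by
  have amgm (w : ℝ) : w ^ 3 ≤ 3 / 4 * w ^ 4 / a + a ^ 3 / 4 := by
    have h : 3 / 4 * w ^ 4 / a + a ^ 3 / 4 - w ^ 3
        = (w - a) ^ 2 * (2 * w ^ 2 + (w + a) ^ 2) / (4 * a) := by
      field_simp; ring
    have : 0 ≤ (w - a) ^ 2 * (2 * w ^ 2 + (w + a) ^ 2) / (4 * a) := by positivity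
    linarith
  induction n with
  | zero =>
    intro w hw0 hw
    have := amgm w
    norm_num at hw ⊢
    linarith
  | succ n ih =>
    intro w hw0 hw
    push_cast at hw
    obtain ⟨v, hv0, hv, -⟩ := exists_cube_root (z := (n : ℝ) + 1) (by positivity)
    replace hv0 := pos_of_cube_eq_succ hv0 hv
    rcases le_total a v with hav | hva
    · rw [Finset.sum_range_succ, polaDelta_eq ha haK hv0 hv,
        min_eq_right ((div_le_one hv0).2 hav), one_div_div]
      have h := ih v hv0 hv
      have h1 : v / a + 3 / 4 * v ^ 4 / a ≤ 3 / 4 * w ^ 4 / a := by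
        rw [← add_div]
        gcongr
        have h2 : w ^ 3 - v ^ 3 = 1 := by linarith
        have h3 : v * (w ^ 3 - v ^ 3) = v := by rw [h2, mul_one]
        have h4 : 0 ≤ (w - v) ^ 2 * (2 * w ^ 2 + (w + v) ^ 2) := by positivity
        nlinarith
      linarith
    · have h : ∑ t ∈ Finset.range (n + 1), 1 / polaDelta K t = w ^ 3 - 1 := by
        rw [hw, Finset.sum_congr rfl (g := fun _ => (1 : ℝ))]
        · simp
        · intro t ht
          obtain ⟨u, hu0, hu, -⟩ := exists_cube_root (z := (t : ℝ) + 1) (by positivity)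
          replace hu0 := pos_of_cube_eq_succ hu0 hu
          have huv : u ≤ v := by
            refine le_of_pow_le_pow_left₀ three_ne_zero hv0.le ?_
            rw [hu, hv]
            have : t ≤ n := by simpa [Nat.lt_succ_iff] using ht
            gcongr
          rw [polaDelta_eq ha haK hu0 hu, min_eq_left ((one_le_div hu0).2 (huv.trans hva)),
            one_div_one]
      have := amgm w
      linarith

/-- Probability of the outcome `o` of round `t + 1`. -/
noncomputable def polaRoundProb (K t : ℕ) (o : Option (Fin K)) : ℝ :=
  match o with
  | some _ => polaDelta K t * (1 / (K : ℝ))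
  | none => 1 - polaDelta K t

/-- Estimated reward of channel `j` in round `t + 1` when the outcome of the round is `o`. -/
noncomputable def polaEst (K : ℕ) (x : ℕ → Fin K → ℝ) (t : ℕ) (o : Option (Fin K))
    (j : Fin K) : ℝ :=
  match o with
  | some j' => if j' = j then x t j * (K : ℝ) / polaDelta K t else 0
  | none => 0

/-- Expectation of a function of the history. -/
noncomputable def polaExp (K T : ℕ) (f : (Fin T → Option (Fin K)) → ℝ) : ℝ :=
  ∑ c : Fin T → Option (Fin K), polaHistProb K T c * f c

theorem polaHistProb_eq (K T : ℕ) (c : Fin T → Option (Fin K)) :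
    polaHistProb K T c = ∏ t : Fin T, polaRoundProb K t (c t) := rfl

theorem sum_polaRoundProb {K : ℕ} (hK : 0 < K) (t : ℕ) :
    ∑ o : Option (Fin K), polaRoundProb K t o = 1 := by
  have : (K : ℝ) ≠ 0 := by positivity
  rw [Fintype.sum_option]
  simp only [polaRoundProb, Finset.sum_const, Finset.card_univ, Fintype.card_fin, nsmul_eq_mul]
  field_simp
  ring

theorem polaHistProb_nonneg {K T : ℕ} (hδ : ∀ t, 0 < polaDelta K t)
    (c : Fin T → Option (Fin K)) : 0 ≤ polaHistProb K T c := by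
  rw [polaHistProb_eq]
  refine Finset.prod_nonneg fun t _ => ?_
  have h1 := hδ t
  have h2 := polaDelta_le_one K t
  unfold polaRoundProb
  split
  · positivity
  · linarith

theorem sum_polaHistProb {K : ℕ} (hK : 0 < K) (T : ℕ) :
    ∑ c : Fin T → Option (Fin K), polaHistProb K T c = 1 := by
  simp_rw [polaHistProb_eq]
  rw [← Fintype.piFinset_univ, ← Finset.prod_univ_sum]
  simp [sum_polaRoundProb hK]

section polaExp

variable {K T : ℕ}

theorem polaExp_mono (hδ : ∀ t, 0 < polaDelta K t) {f g : (Fin T → Option (Fin K)) → ℝ}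
    (h : ∀ c, f c ≤ g c) : polaExp K T f ≤ polaExp K T g :=
  Finset.sum_le_sum fun c _ => mul_le_mul_of_nonneg_left (h c) (polaHistProb_nonneg hδ c)

theorem polaExp_const (hK : 0 < K) (r : ℝ) : polaExp K T (fun _ => r) = r := by
  rw [polaExp, ← Finset.sum_mul, sum_polaHistProb hK, one_mul]

theorem polaExp_add (f g : (Fin T → Option (Fin K)) → ℝ) :
    polaExp K T (fun c => f c + g c) = polaExp K T f + polaExp K T g := by
  simp [polaExp, mul_add, Finset.sum_add_distrib]

theorem polaExp_const_mul (r : ℝ) (f : (Fin T → Option (Fin K)) → ℝ) :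
    polaExp K T (fun c => r * f c) = r * polaExp K T f := by
  simp only [polaExp, Finset.mul_sum, mul_left_comm]

theorem polaExp_sum {ι : Type*} (s : Finset ι) (f : ι → (Fin T → Option (Fin K)) → ℝ) :
    polaExp K T (fun c => ∑ i ∈ s, f i c) = ∑ i ∈ s, polaExp K T (f i) := by
  simp only [polaExp, Finset.mul_sum]
  exact Finset.sum_comm

/-- The outcome of a round is independent of anything that does not depend on it. -/
theorem polaExp_mul_apply (hK : 0 < K) (t : Fin T) (g : (Fin T → Option (Fin K)) → ℝ)
    (hg : ∀ c o, g (Function.update c t o) = g c) (φ : Option (Fin K) → ℝ) :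
    polaExp K T (fun c => g c * φ (c t))
      = polaExp K T g * ∑ o, polaRoundProb K t o * φ o := by
  have hswap (c : Fin T → Option (Fin K)) (o : Option (Fin K)) :
      polaHistProb K T (Function.update c t o) * polaRoundProb K t (c t)
        = polaHistProb K T c * polaRoundProb K t o := by
    simp only [polaHistProb_eq]
    rw [Fintype.prod_eq_mul_prod_compl t, Fintype.prod_eq_mul_prod_compl t,
      Function.update_self]
    have : ∏ i ∈ {t}ᶜ, polaRoundProb K i (Function.update c t o i)
        = ∏ i ∈ {t}ᶜ, polaRoundProb K i (c i) :=
      Finset.prod_congr rfl fun i hi => by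
        rw [Function.update_of_ne (by simpa using hi)]
    rw [this]
    ring
  calc polaExp K T (fun c => g c * φ (c t))
      = ∑ p : (Fin T → Option (Fin K)) × Option (Fin K),
          polaHistProb K T p.1 * polaRoundProb K t p.2 * (g p.1 * φ (p.1 t)) := by
        rw [Fintype.sum_prod_type]
        refine Finset.sum_congr rfl fun c _ => ?_
        simp only [← Finset.sum_mul, ← Finset.mul_sum]
        rw [sum_polaRoundProb hK, mul_one]
    _ = ∑ p : (Fin T → Option (Fin K)) × Option (Fin K),
          polaHistProb K T p.1 * polaRoundProb K t p.2 * (g p.1 * φ p.2) := by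
        refine Finset.sum_nbij' (fun p => (Function.update p.1 t p.2, p.1 t))
          (fun p => (Function.update p.1 t p.2, p.1 t)) ?_ ?_ ?_ ?_ ?_
        · simp
        · simp
        · simp
        · simp
        · rintro ⟨c, o⟩ -
          simp only [hswap, hg]
    _ = polaExp K T g * ∑ o, polaRoundProb K t o * φ o := by
        rw [Fintype.sum_prod_type, polaExp, Finset.sum_mul]
        refine Finset.sum_congr rfl fun c _ => ?_
        rw [Finset.mul_sum]
        exact Finset.sum_congr rfl fun o _ => by ring

end polaExp

theorem sum_polaRoundProb_mul_polaEst {K : ℕ} (hK : 0 < K) (x : ℕ → Fin K → ℝ) {t : ℕ}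
    (hδ : 0 < polaDelta K t) (j : Fin K) :
    ∑ o, polaRoundProb K t o * polaEst K x t o j = x t j := by
  rw [Fintype.sum_option]
  simp [polaRoundProb, polaEst]
  field_simp

theorem sum_polaRoundProb_mul_polaEst_sq {K : ℕ} (hK : 0 < K) (x : ℕ → Fin K → ℝ) {t : ℕ}
    (hδ : 0 < polaDelta K t) (j : Fin K) :
    ∑ o, polaRoundProb K t o * polaEst K x t o j ^ 2 = x t j ^ 2 * (K / polaDelta K t) := by
  rw [Fintype.sum_option]
  simp [polaRoundProb, polaEst]
  field_simp

section weights

variable {K T : ℕ} (x : ℕ → Fin K → ℝ) (η : ℝ)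

theorem polaWeight_succ (c : Fin T → Option (Fin K)) (t : Fin T) (j : Fin K) :
    polaWeight K T x η c (t + 1) j
      = polaWeight K T x η c t j * Real.exp (η * polaEst K x t (c t) j) := by
  simp only [polaWeight, t.isLt, dite_true, polaEst]

theorem polaWeight_pos (c : Fin T → Option (Fin K)) (t : ℕ) (j : Fin K) :
    0 < polaWeight K T x η c t j := by
  induction t with
  | zero => simp [polaWeight]
  | succ t ih => exact mul_pos ih (Real.exp_pos _)

theorem polaWeight_congr {c c' : Fin T → Option (Fin K)} {t : ℕ}
    (h : ∀ s : Fin T, (s : ℕ) < t → c s = c' s) :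
    polaWeight K T x η c t = polaWeight K T x η c' t := by
  induction t with
  | zero => rfl
  | succ t ih =>
    ext j
    by_cases ht : t < T
    · rw [polaWeight_succ x η c ⟨t, ht⟩, polaWeight_succ x η c' ⟨t, ht⟩,
        ih fun s hs => h s (hs.trans t.lt_succ_self), h ⟨t, ht⟩ t.lt_succ_self]
    · simp only [polaWeight, ht, dite_false, ih fun s hs => h s (hs.trans t.lt_succ_self)]

theorem polaP_update (c : Fin T → Option (Fin K)) (t : Fin T) (o : Option (Fin K)) :
    polaP K T x η (Function.update c t o) t = polaP K T x η c t := by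
  have : polaWeight K T x η (Function.update c t o) t = polaWeight K T x η c t :=
    polaWeight_congr x η fun s hs =>
      Function.update_of_ne (fun h => by simp [h] at hs) _ _
  ext i
  rw [polaP, polaP, this]

theorem polaP_nonneg (c : Fin T → Option (Fin K)) (t : ℕ) (i : Fin K) :
    0 ≤ polaP K T x η c t i :=
  div_nonneg (polaWeight_pos x η c t i).le
    (Finset.sum_nonneg fun j _ => (polaWeight_pos x η c t j).le)

theorem sum_polaWeight_pos (hK : 0 < K) (c : Fin T → Option (Fin K)) (t : ℕ) :
    0 < ∑ j, polaWeight K T x η c t j :=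
  Finset.sum_pos (fun j _ => polaWeight_pos x η c t j) ⟨⟨0, hK⟩, Finset.mem_univ _⟩

theorem sum_polaP (hK : 0 < K) (c : Fin T → Option (Fin K)) (t : ℕ) :
    ∑ i, polaP K T x η c t i = 1 := by
  simp only [polaP]
  rw [← Finset.sum_div, div_self (sum_polaWeight_pos x η hK c t).ne']

theorem polaWeight_eq_exp (c : Fin T → Option (Fin K)) (j : Fin K) (n : ℕ) (hn : n ≤ T) :
    polaWeight K T x η c n j
      = Real.exp (η * ∑ t : Fin n, polaEst K x t (c (Fin.castLE hn t)) j) := by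
  induction n with
  | zero => simp [polaWeight]
  | succ n ih =>
    rw [polaWeight_succ x η c ⟨n, hn⟩, ih (Nat.le_of_succ_le hn), ← Real.exp_add, ← mul_add,
      Fin.sum_univ_castSucc]
    rfl

theorem sum_polaWeight_le_exp (hK : 0 < K) (c : Fin T → Option (Fin K))
    (hη : ∀ (t : Fin T) j, 0 ≤ η * polaEst K x t (c t) j ∧ η * polaEst K x t (c t) j ≤ 1)
    (n : ℕ) (hn : n ≤ T) :
    ∑ j, polaWeight K T x η c n j ≤ K * Real.exp (∑ t : Fin n, ∑ i,
      polaP K T x η c t i * (η * polaEst K x t (c (Fin.castLE hn t)) i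
        + (Real.exp 1 - 2) * (η * polaEst K x t (c (Fin.castLE hn t)) i) ^ 2)) := by
  induction n with
  | zero => simp [polaWeight]
  | succ n ih =>
    have hW := sum_polaWeight_pos x η hK c n
    set y : Fin K → ℝ := fun i => η * polaEst K x n (c ⟨n, hn⟩) i with hy
    set S : ℝ := ∑ i, polaP K T x η c n i * (y i + (Real.exp 1 - 2) * y i ^ 2) with hS
    have step : ∑ j, polaWeight K T x η c (n + 1) j
        ≤ (∑ j, polaWeight K T x η c n j) * Real.exp S := by
      calc ∑ j, polaWeight K T x η c (n + 1) j
          ≤ ∑ j, polaWeight K T x η c n j * (1 + y j + (Real.exp 1 - 2) * y j ^ 2) := by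
            refine Finset.sum_le_sum fun j _ => ?_
            rw [polaWeight_succ x η c ⟨n, hn⟩]
            exact mul_le_mul_of_nonneg_left
              (exp_le_one_add_add_sq (hη ⟨n, hn⟩ j).1 (hη ⟨n, hn⟩ j).2)
              (polaWeight_pos x η c n j).le
        _ = (∑ j, polaWeight K T x η c n j) * (S + 1) := by
            rw [mul_add, mul_one, hS, Finset.mul_sum, ← Finset.sum_add_distrib]
            refine Finset.sum_congr rfl fun j _ => ?_
            rw [polaP]
            field_simp
            ring
        _ ≤ _ := mul_le_mul_of_nonneg_left (Real.add_one_le_exp S) hW.le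
    rw [Fin.sum_univ_castSucc, Real.exp_add, ← mul_assoc]
    exact step.trans (mul_le_mul_of_nonneg_right (ih (Nat.le_of_succ_le hn))
      (Real.exp_pos _).le)

theorem polaEst_regret_le (hK : 0 < K) (c : Fin T → Option (Fin K))
    (hη : ∀ (t : Fin T) j, 0 ≤ η * polaEst K x t (c t) j ∧ η * polaEst K x t (c t) j ≤ 1)
    (j : Fin K) :
    η * ∑ t : Fin T, polaEst K x t (c t) j ≤ Real.log K + ∑ t : Fin T, ∑ i,
      polaP K T x η c t i * (η * polaEst K x t (c t) i
        + (Real.exp 1 - 2) * (η * polaEst K x t (c t) i) ^ 2) := by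
  have h1 := sum_polaWeight_le_exp x η hK c hη T le_rfl
  have h2 := polaWeight_eq_exp x η c j T le_rfl
  have h3 : polaWeight K T x η c T j ≤ ∑ j, polaWeight K T x η c T j :=
    Finset.single_le_sum (fun j _ => (polaWeight_pos x η c T j).le) (Finset.mem_univ j)
  have hK' : (0 : ℝ) < K := by positivity
  rw [← Real.exp_le_exp, Real.exp_add, Real.exp_log hK']
  exact (h2 ▸ h3).trans h1

theorem polaGain_eq (hK : 0 < K) :
    polaGain K T x η = ∑ t : Fin T, (1 - polaDelta K t)
      * polaExp K T (fun c => ∑ i, polaP K T x η c t i * x t i) := by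
  have h : polaGain K T x η = polaExp K T (fun c => ∑ t : Fin T,
      (∑ i, polaP K T x η c t i * x t i) * (if c t = none then 1 else 0)) := by
    refine Finset.sum_congr rfl fun c _ => ?_
    congr 1
    refine Finset.sum_congr rfl fun t _ => ?_
    cases c t <;> simp
  rw [h, polaExp_sum]
  refine Finset.sum_congr rfl fun t _ => ?_
  rw [polaExp_mul_apply hK t (fun c => ∑ i, polaP K T x η c t i * x t i)
    (fun c o => by simp only [polaP_update]) (fun o => if o = none then 1 else 0), mul_comm]
  congr 1
  rw [Fintype.sum_option]
  simp [polaRoundProb]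

theorem pola_regret_le (hK : 0 < K) (hδ : ∀ t, 0 < polaDelta K t) (hη : 0 < η)
    (hηδ : ∀ t < T, η * (K / polaDelta K t) ≤ 1)
    (hx : ∀ t < T, ∀ j, 0 ≤ x t j ∧ x t j ≤ 1) (j : Fin K) :
    ∑ t ∈ Finset.range T, x t j - polaGain K T x η
      ≤ ∑ t ∈ Finset.range T, polaDelta K t + Real.log K / η
        + (Real.exp 1 - 2) * η * K * ∑ t ∈ Finset.range T, 1 / polaDelta K t := by
  have he : 0 < Real.exp 1 - 2 := by linarith [Real.exp_one_gt_d9]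
  have hest (c : Fin T → Option (Fin K)) (t : Fin T) (j : Fin K) :
      0 ≤ η * polaEst K x t (c t) j ∧ η * polaEst K x t (c t) j ≤ 1 := by
    have hxt := hx t t.isLt j
    have hpos : 0 ≤ η * (K / polaDelta K t) := by have := hδ t; positivity
    unfold polaEst
    split
    · split_ifs
      · have : η * (x t j * K / polaDelta K t) = x t j * (η * (K / polaDelta K t)) := by ring
        rw [this]
        exact ⟨mul_nonneg hxt.1 hpos, mul_le_one₀ hxt.2 hpos (hηδ t t.isLt)⟩
      · simp
    · simp
  have hE := polaExp_mono hδ fun c => polaEst_regret_le x η hK c (hest c) j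
  set A : Fin T → ℝ := fun t => polaExp K T (fun c => ∑ i, polaP K T x η c t i * x t i) with hA
  have hP (t : Fin T) (i : Fin K) (φ : Option (Fin K) → ℝ) :
      polaExp K T (fun c => polaP K T x η c t i * φ (c t))
        = polaExp K T (fun c => polaP K T x η c t i) * ∑ o, polaRoundProb K t o * φ o :=
    polaExp_mul_apply hK t (fun c => polaP K T x η c t i)
      (fun c o => by rw [polaP_update]) φ
  have hleft : polaExp K T (fun c => η * ∑ t : Fin T, polaEst K x t (c t) j)
      = η * ∑ t : Fin T, x t j := by
    rw [polaExp_const_mul, polaExp_sum]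
    congr 1
    refine Finset.sum_congr rfl fun t _ => ?_
    have := polaExp_mul_apply hK t (fun _ => 1) (fun _ _ => rfl) (fun o => polaEst K x t o j)
    simpa [polaExp_const hK, sum_polaRoundProb_mul_polaEst hK x (hδ t)] using this
  have hterm (t : Fin T) : polaExp K T (fun c => ∑ i, polaP K T x η c t i
      * (η * polaEst K x t (c t) i + (Real.exp 1 - 2) * (η * polaEst K x t (c t) i) ^ 2))
      ≤ η * A t + (Real.exp 1 - 2) * η ^ 2 * K * (1 / polaDelta K t) := by
    have hsplit : polaExp K T (fun c => ∑ i, polaP K T x η c t i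
        * (η * polaEst K x t (c t) i + (Real.exp 1 - 2) * (η * polaEst K x t (c t) i) ^ 2))
        = η * A t + (Real.exp 1 - 2) * η ^ 2 * K * (1 / polaDelta K t)
          * polaExp K T (fun c => ∑ i, polaP K T x η c t i * x t i ^ 2) := by
      simp only [hA]
      rw [polaExp_sum, polaExp_sum, polaExp_sum, Finset.mul_sum, Finset.mul_sum,
        ← Finset.sum_add_distrib]
      refine Finset.sum_congr rfl fun i _ => ?_
      have h1 := hP t i (fun o => polaEst K x t o i)
      have h2 := hP t i (fun o => polaEst K x t o i ^ 2)
      have h3 := hP t i (fun _ => x t i)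
      have h4 := hP t i (fun _ => x t i ^ 2)
      rw [sum_polaRoundProb_mul_polaEst hK x (hδ t)] at h1
      rw [sum_polaRoundProb_mul_polaEst_sq hK x (hδ t)] at h2
      rw [← Finset.sum_mul, sum_polaRoundProb hK, one_mul] at h3 h4
      rw [h3, h4]
      trans η * polaExp K T (fun c => polaP K T x η c t i * polaEst K x t (c t) i)
        + (Real.exp 1 - 2) * η ^ 2
          * polaExp K T (fun c => polaP K T x η c t i * polaEst K x t (c t) i ^ 2)
      · rw [← polaExp_const_mul, ← polaExp_const_mul, ← polaExp_add]
        congr 1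
        ext c
        ring
      · rw [h1, h2]
        ring
    have hle : polaExp K T (fun c => ∑ i, polaP K T x η c t i * x t i ^ 2) ≤ 1 := by
      refine (polaExp_mono hδ (g := fun _ => 1) fun c => ?_).trans_eq (polaExp_const hK 1)
      rw [← sum_polaP x η hK c t]
      exact Finset.sum_le_sum fun i _ => mul_le_of_le_one_right (polaP_nonneg x η c t i)
        (pow_le_one₀ (hx t t.isLt i).1 (hx t t.isLt i).2)
    rw [hsplit]
    have : 0 ≤ (Real.exp 1 - 2) * η ^ 2 * K * (1 / polaDelta K t) := by
      have := hδ t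
      positivity
    linarith [mul_le_mul_of_nonneg_left hle this]
  have hA1 (t : Fin T) : A t ≤ 1 := by
    refine (polaExp_mono hδ (g := fun _ => 1) fun c => ?_).trans_eq (polaExp_const hK 1)
    rw [← sum_polaP x η hK c t]
    exact Finset.sum_le_sum fun i _ => mul_le_of_le_one_right (polaP_nonneg x η c t i)
      (hx t t.isLt i).2
  rw [hleft, polaExp_add, polaExp_const hK, polaExp_sum] at hE
  replace hE := hE.trans (add_le_add_right (Finset.sum_le_sum fun t _ => hterm t) _)
  rw [Finset.sum_add_distrib, ← Finset.mul_sum, ← Finset.mul_sum] at hE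
  have hgain : ∑ t, A t - ∑ t : Fin T, polaDelta K t ≤ polaGain K T x η := by
    rw [polaGain_eq x η hK, ← Finset.sum_sub_distrib]
    refine Finset.sum_le_sum fun t _ => ?_
    have := mul_le_mul_of_nonneg_left (hA1 t) (hδ t).le
    change A t - polaDelta K t ≤ (1 - polaDelta K t) * A t
    linarith
  simp only [Finset.sum_range]
  have hdiv : ∑ t : Fin T, x t j ≤ ∑ t, A t + Real.log K / η
      + (Real.exp 1 - 2) * η * K * ∑ t : Fin T, 1 / polaDelta K t := by
    refine le_of_mul_le_mul_left (hE.trans_eq ?_) hη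
    field_simp
    ring
  linarith

end weights

/-- for any `K ≥ 2` and any horizon
`T ≥ (8/(3·√(3(e−2)³)))·K·ln K` (numerically `T ≥ 2.577·K·ln K`), if POLA is
run with learning rate
`η = √(ln K/((e−2)·K·((3/4)·((T+1)⁴/(K·ln K))^{1/3} + K·ln K/4)))`,
then for any rewards `x t j ∈ [0,1]`,
`G_max − E[G_POLA] ≤ (√(3(e−2)) + 3/2)·(T²·K·ln K)^{1/3}`,
where `G_max = max_j ∑_t x t j`. -/
theorem pola_tuned_regret_upper_bound (K T : ℕ) (hK : 2 ≤ K)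
    (hT : 8 / (3 * Real.sqrt (3 * (Real.exp 1 - 2) ^ 3)) *
        ((K : ℝ) * Real.log K) ≤ (T : ℝ))
    (x : ℕ → Fin K → ℝ) (hx : ∀ t < T, ∀ j, 0 ≤ x t j ∧ x t j ≤ 1) :
    (Finset.univ.sup' (⟨⟨0, by omega⟩, Finset.mem_univ _⟩ :
          (Finset.univ : Finset (Fin K)).Nonempty)
        fun j : Fin K => ∑ t ∈ Finset.range T, x t j) -
        polaGain K T x
          (Real.sqrt (Real.log K /
            ((Real.exp 1 - 2) * (K : ℝ) *
              ((3 / 4) * ((((T : ℝ) + 1) ^ 4 / ((K : ℝ) * Real.log K)) ^ ((1 : ℝ) / 3)) +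
                (K : ℝ) * Real.log K / 4)))) ≤
      (Real.sqrt (3 * (Real.exp 1 - 2)) + 3 / 2) *
        (((T : ℝ) ^ 2 * (K : ℝ) * Real.log K) ^ ((1 : ℝ) / 3)) := by
  have hK0 : 0 < K := by omega
  have hKr : (2 : ℝ) ≤ K := by exact_mod_cast hK
  have hK0r : (0 : ℝ) < K := by linarith
  have he1 := Real.exp_one_gt_d9
  have he2 := Real.exp_one_lt_d9
  have hlog2 : Real.log 2 ≤ Real.log K := Real.log_le_log (by norm_num) hKr
  have hlog : 0.6931 ≤ Real.log K := by linarith [Real.log_two_gt_d9]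
  have hL : 1.3862 ≤ (K : ℝ) * Real.log K := by nlinarith
  set e : ℝ := Real.exp 1 - 2 with he
  have he0 : 0 < e := by linarith
  obtain ⟨a, ha0, haK, -⟩ := exists_cube_root (z := (K : ℝ) * Real.log K) (by linarith)
  obtain ⟨v, hv0, hvT, -⟩ := exists_cube_root (z := (T : ℝ)) (by positivity)
  obtain ⟨w, hw0, hwT, -⟩ := exists_cube_root (z := (T : ℝ) + 1) (by positivity)
  replace hw0 := pos_of_cube_eq_succ hw0 hwT
  replace ha0 : 0 < a := by
    refine lt_of_pow_lt_pow_left₀ 3 ha0 ?_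
    rw [haK]
    linarith
  have hvw : v ≤ w := le_of_pow_le_pow_left₀ three_ne_zero hw0.le (by linarith)
  -- the threshold on `T` in terms of `v / a`
  have hthr : 4 / (3 * e) * a ^ 2 ≤ v ^ 2 := by
    have h1 : (8 / (3 * Real.sqrt (3 * e ^ 3))) ^ 2 = (4 / (3 * e)) ^ 3 := by
      rw [div_pow, mul_pow, Real.sq_sqrt (by positivity)]
      field_simp
      norm_num
    rw [← haK, ← hvT] at hT
    refine le_of_pow_le_pow_left₀ three_ne_zero (by positivity) ?_
    have h2 := pow_le_pow_left₀ (by positivity) hT 2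
    rw [mul_pow, h1] at h2
    linarith
  have hva : 1.36 * a ≤ v := by
    refine le_of_sq_le_sq ?_ hv0
    have h1 : 1.36 ^ 2 ≤ 4 / (3 * e) := by
      rw [le_div_iff₀ (by positivity)]
      norm_num
      linarith
    have := mul_le_mul_of_nonneg_right h1 (sq_nonneg a)
    rw [mul_pow]
    linarith
  have hav : a ≤ v := by linarith
  replace hv0 : 0 < v := by linarith
  have hδ (t : ℕ) : 0 < polaDelta K t := by
    rw [polaDelta]
    have : 0 < (K : ℝ) * Real.log K := by linarith
    positivity
  set B : ℝ := 3 / 4 * w ^ 4 / a + a ^ 3 / 4 with hB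
  have hB0 : 0 < B := by positivity
  have hBeq : (3 / 4) * ((((T : ℝ) + 1) ^ 4 / ((K : ℝ) * Real.log K)) ^ ((1 : ℝ) / 3)) +
      (K : ℝ) * Real.log K / 4 = B := by
    rw [rpow_one_third_eq (v := w ^ 4 / a) (by positivity)
      (by rw [div_pow, haK, ← hwT]; ring), ← haK, hB]
    ring
  have hG : ((T : ℝ) ^ 2 * (K : ℝ) * Real.log K) ^ ((1 : ℝ) / 3) = v ^ 2 * a :=
    rpow_one_third_eq (by positivity) (by rw [mul_assoc, ← haK, ← hvT]; ring)
  rw [hBeq, hG]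
  have hlog0 : 0 < Real.log K := by linarith
  set η : ℝ := Real.sqrt (Real.log K / (e * K * B)) with hη
  have hη0 : 0 < η := Real.sqrt_pos.2 (by positivity)
  have hη2 : η ^ 2 = Real.log K / (e * K * B) :=
    Real.sq_sqrt (by positivity)
  have hηδ : ∀ t < T, η * (K / polaDelta K t) ≤ 1 := by
    intro t ht
    have hδt : 1 / polaDelta K t ≤ v / a := by
      obtain ⟨u, hu0, hu, -⟩ := exists_cube_root (z := (t : ℝ) + 1) (by positivity)
      replace hu0 := pos_of_cube_eq_succ hu0 hu
      have huv : u ≤ v := by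
        refine le_of_pow_le_pow_left₀ three_ne_zero hv0.le ?_
        rw [hu, hvT]
        exact_mod_cast ht
      rw [← one_div_div a v]
      refine one_div_le_one_div_of_le (by positivity) ?_
      rw [polaDelta_eq ha0 haK hu0 hu]
      exact le_min ((div_le_one hv0).2 hav) (by gcongr)
    have h1 : η * (K * (v / a)) ≤ 1 := by
      refine le_of_sq_le_sq ?_ zero_le_one
      have h2 : (η * (K * (v / a))) ^ 2 = a * v ^ 2 / (e * B) := by
        rw [mul_pow, hη2]
        have : Real.log K = a ^ 3 / K := by rw [haK]; field_simp
        rw [this]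
        field_simp
      rw [h2, one_pow, div_le_one (by positivity)]
      have h3 : 3 / 4 * v ^ 4 / a ≤ B := by
        have : 3 / 4 * v ^ 4 / a ≤ 3 / 4 * w ^ 4 / a := by gcongr
        have : 0 ≤ a ^ 3 / 4 := by positivity
        linarith
      have h4 : a * v ^ 2 ≤ e * (3 / 4 * v ^ 4 / a) := by
        have : e * (3 / 4 * v ^ 4 / a) - a * v ^ 2
            = 3 * e / 4 * v ^ 2 / a * (v ^ 2 - 4 / (3 * e) * a ^ 2) := by
          field_simp
        have : 0 ≤ 3 * e / 4 * v ^ 2 / a * (v ^ 2 - 4 / (3 * e) * a ^ 2) :=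
          mul_nonneg (by positivity) (by linarith)
        linarith
      exact h4.trans (mul_le_mul_of_nonneg_left h3 he0.le)
    refine le_trans ?_ h1
    rw [div_eq_mul_one_div (K : ℝ)]
    gcongr
  have hsum := sum_polaDelta_le ha0 haK T v hvT hav
  have hinv := sum_inv_polaDelta_le ha0 haK T w hw0 hwT
  rw [← hB] at hinv
  -- the two terms depending on `η`
  set k : ℝ := Real.sqrt e with hk
  have hk0 : 0 < k := Real.sqrt_pos.2 he0
  have hk2 : k ^ 2 = e := Real.sq_sqrt he0.le
  have hk1 : k ≤ 0.8476 := by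
    rw [hk, Real.sqrt_le_left (by norm_num)]
    norm_num
    linarith
  set y : ℝ := Real.sqrt (B / a ^ 3) with hy
  have hy0 : 0 < y := Real.sqrt_pos.2 (by positivity)
  have hy2 : y ^ 2 = B / a ^ 3 := Real.sq_sqrt (by positivity)
  have hηy : η * (k * K * y) = 1 := by
    rw [← pow_left_inj₀ (by positivity) zero_le_one two_ne_zero]
    rw [mul_pow, mul_pow, mul_pow, hη2, hk2, hy2, haK]
    field_simp
  have hlogη : Real.log K / η = k * a ^ 3 * y := by
    rw [haK, div_eq_iff hη0.ne']
    linear_combination (-Real.log K) * hηy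
  have hηB : e * η * K * B = k * a ^ 3 * y := by
    have : B = y ^ 2 * a ^ 3 := by rw [hy2]; field_simp
    rw [this, ← hk2]
    linear_combination (k * a ^ 3 * y) * hηy
  have hηe : e * η * K = k / y := by
    rw [eq_div_iff hy0.ne', ← hk2]
    linear_combination k * hηy
  have hnum := rescaled_tuning_bound (q := v / a) (r := w / a) (h := 1 / a ^ 3) (y := y)
    ((le_div_iff₀ ha0).2 hva) (by positivity) (by positivity)
    (by rw [div_le_iff₀ (by positivity), haK]; linarith)
    (by rw [div_pow, div_pow, hvT, hwT, add_div]) hy0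
    (by rw [hy2, hB]; field_simp)
  have hfin : k * a ^ 3 * y + e * η * K * (B - 1)
      ≤ Real.sqrt (3 * e) * (v ^ 2 * a) + a ^ 3 / 2 := by
    have h1 := mul_le_mul_of_nonneg_left hnum (by positivity : 0 ≤ k * a ^ 3)
    have h2 : k * a ^ 3 * (2 * y - 1 / a ^ 3 / y) = 2 * (k * a ^ 3 * y) - k / y := by
      field_simp
    have h3 : k * a ^ 3 * (Real.sqrt 3 * (v / a) ^ 2 + 0.589)
        = Real.sqrt (3 * e) * (v ^ 2 * a) + 0.589 * k * a ^ 3 := by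
      rw [Real.sqrt_mul (by norm_num), ← hk]
      field_simp
    have h4 : 0.589 * k * a ^ 3 ≤ 1 / 2 * a ^ 3 := by
      gcongr
      linarith
    rw [mul_sub, mul_one, hηB, hηe]
    linarith
  have hmono := mul_le_mul_of_nonneg_left hinv (by positivity : 0 ≤ e * η * K)
  rw [sub_le_iff_le_add]
  refine Finset.sup'_le _ _ fun j _ => ?_
  have hreg := pola_regret_le x η hK0 hδ hη0 hηδ hx j
  rw [← he, hlogη] at hreg
  linarith
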